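/- Let (Y_n^y)_{n∈ℕ₀}, y ∈ Y, be a family of Markov chains on a metric space Y with common transition probability function {π_y : y ∈ Y}, and suppose V : Y → [0,∞) satisfies ∫_Y V(x) π_y(dx) ≤ aV(y) + b for all y ∈ Y, where a ∈ (0,1) and b > 0. Then there exist λ ∈ (0,1) and C̃ > 0 such that for the stopping time ρ((y_k)) = inf{k ≥ 1 : V(y_k) < 2b/(1−a)} one has E_y λ^{-ρ} ≤ C̃(V(y)+1) for all y ∈ Y. -/

import Mathlib

open MeasureTheory ProbabilityTheory Filter Set
open scoped ENNReal NNReal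

noncomputable section

/-- `geomInv t n = (t⁻¹)^n`, i.e. `t^{-n}`, with value `∞` at `n = ∞`. -/
def geomInv (t : ℝ) (n : ℕ∞) : ℝ≥0∞ :=
  if n = ⊤ then ⊤ else ENNReal.ofReal (t⁻¹ ^ n.toNat)

/-- Prepend a point to a path. -/
def prepend {Y : Type*} (y : Y) (ω : ℕ → Y) : ℕ → Y :=
  fun n => Nat.casesOn n y ω

/-- The truncation `t ^ (ρ ∧ n)` of `t ^ ρ`, where `ρ` is the first time `k ≥ 1` at which the path
enters the set where `V < c`. -/
def truncPow {Y : Type*} (V : Y → ℝ) (c : ℝ) (t : ℝ≥0∞) : ℕ → (ℕ → Y) → ℝ≥0∞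
  | 0, _ => 1
  | n + 1, ω => t * {ω : ℕ → Y | V (ω 1) < c}.piecewise (fun _ => 1)
      (fun ω => truncPow V c t n fun k => ω (k + 1)) ω

section

variable {Y : Type*} {V : Y → ℝ} {c : ℝ} {t : ℝ≥0∞}

lemma truncPow_succ_of_lt {ω : ℕ → Y} (n : ℕ) (h : V (ω 1) < c) :
    truncPow V c t (n + 1) ω = t := by
  simp [truncPow, h]

lemma truncPow_succ_of_le {ω : ℕ → Y} (n : ℕ) (h : c ≤ V (ω 1)) :
    truncPow V c t (n + 1) ω = t * truncPow V c t n fun k => ω (k + 1) := by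
  simp [truncPow, h]

lemma truncPow_eq_pow (n : ℕ) (ω : ℕ → Y) (h : ∀ k, 1 ≤ k → k < n → c ≤ V (ω k)) :
    truncPow V c t n ω = t ^ n := by
  induction n generalizing ω with
  | zero => simp [truncPow]
  | succ n ih =>
    rcases lt_or_ge (V (ω 1)) c with h1 | h1
    · obtain rfl : n = 0 := by
        by_contra hn
        exact absurd (h 1 le_rfl (by omega)) (not_le.2 h1)
      simp [truncPow_succ_of_lt 0 h1]
    · rw [truncPow_succ_of_le n h1, ih _ fun k _ hk => h (k + 1) (by omega) (by omega), pow_succ']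

lemma truncPow_le_succ (ht : 1 ≤ t) (n : ℕ) (ω : ℕ → Y) :
    truncPow V c t n ω ≤ truncPow V c t (n + 1) ω := by
  induction n generalizing ω with
  | zero => simpa [truncPow_eq_pow 1 ω (by omega), truncPow] using ht
  | succ n ih =>
    rcases lt_or_ge (V (ω 1)) c with h1 | h1
    · simp only [truncPow_succ_of_lt _ h1, le_refl]
    · rw [truncPow_succ_of_le n h1, truncPow_succ_of_le (n + 1) h1]
      gcongr
      exact ih _

lemma geomInv_le_iSup_truncPow {lam : ℝ} (h0 : 0 < lam) (h1 : lam < 1) (ω : ℕ → Y) :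
    geomInv lam (⨅ k ∈ {k : ℕ | 1 ≤ k ∧ V (ω k) < c}, (k : ℕ∞)) ≤
      ⨆ n, truncPow V c (ENNReal.ofReal lam⁻¹) n ω := by
  classical
  have ht : 1 < ENNReal.ofReal lam⁻¹ := by
    rw [ENNReal.one_lt_ofReal]
    exact (one_lt_inv₀ h0).2 h1
  by_cases hex : ∃ k, 1 ≤ k ∧ V (ω k) < c
  · have hinf : (⨅ k ∈ {k : ℕ | 1 ≤ k ∧ V (ω k) < c}, (k : ℕ∞)) = (Nat.find hex : ℕ∞) :=
      le_antisymm (iInf₂_le (Nat.find hex) (Nat.find_spec hex))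
        (le_iInf₂ fun k hk => by exact_mod_cast Nat.find_min' hex hk)
    rw [hinf]
    refine le_trans (le_of_eq ?_) (le_iSup _ (Nat.find hex))
    rw [truncPow_eq_pow _ _ fun k hk hlt => ?_]
    · simp [geomInv, ← ENNReal.ofReal_pow (inv_nonneg.2 h0.le)]
    · by_contra hc
      exact Nat.find_min hex hlt ⟨hk, not_le.1 hc⟩
  · push Not at hex
    simp_rw [truncPow_eq_pow _ _ fun k hk _ => hex k hk]
    rw [iSup_eq_of_tendsto (pow_right_mono₀ ht.le) (ENNReal.tendsto_pow_atTop_nhds_top_iff.2 ht)]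
    exact le_top

variable [MeasurableSpace Y]

lemma measurable_prepend (y : Y) : Measurable (prepend y) := by
  refine measurable_pi_lambda _ fun n => ?_
  cases n with
  | zero => exact measurable_const
  | succ n => exact measurable_pi_apply n

lemma measurable_truncPow (hV : Measurable V) (n : ℕ) : Measurable (truncPow V c t n) := by
  induction n with
  | zero => exact measurable_const
  | succ n ih =>
    refine Measurable.const_mul (Measurable.piecewise ?_ measurable_const
      (ih.comp (measurable_pi_lambda _ fun k => measurable_pi_apply _))) _
    exact measurableSet_lt (hV.comp (measurable_pi_apply 1)) measurable_const

lemma lintegral_truncPow_succ_le (π : Kernel Y Y) [IsMarkovKernel π]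
    {Ppath : Y → Measure (ℕ → Y)} (hmeas : Measurable Ppath)
    (hprob : ∀ y, IsProbabilityMeasure (Ppath y))
    (hrec : ∀ y, Ppath y = ((π y).bind Ppath).map (prepend y))
    (hV : Measurable V) (n : ℕ) {K : ℝ≥0∞}
    (hK : ∀ x, c ≤ V x → ∫⁻ ω, truncPow V c t n ω ∂Ppath x ≤ K * ENNReal.ofReal (V x)) (y : Y) :
    ∫⁻ ω, truncPow V c t (n + 1) ω ∂Ppath y ≤
      t * (1 + K * ∫⁻ x, ENNReal.ofReal (V x) ∂π y) := by
  have hG := measurable_truncPow (c := c) (t := t) hV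
  have hstart (x : Y) : ∀ᵐ ω ∂Ppath x, V (ω 0) = V x := by
    have hset : MeasurableSet {ω : ℕ → Y | V (ω 0) = V x} :=
      measurableSet_eq_fun (hV.comp (measurable_pi_apply 0)) measurable_const
    rw [hrec x, ae_map_iff (measurable_prepend x).aemeasurable hset]
    exact Eventually.of_forall fun _ => rfl
  have hbound (x : Y) : ∫⁻ ω, truncPow V c t (n + 1) (prepend y ω) ∂Ppath x ≤
      t * (1 + K * ENNReal.ofReal (V x)) := by
    rcases lt_or_ge (V x) c with h | h
    · calc
        _ = ∫⁻ _, t ∂Ppath x := lintegral_congr_ae <| by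
            filter_upwards [hstart x] with ω hω
            exact truncPow_succ_of_lt n (show V (ω 0) < c from hω ▸ h)
        _ = t * 1 := by simp
        _ ≤ _ := by gcongr; exact le_self_add
    · calc
        _ = ∫⁻ ω, t * truncPow V c t n ω ∂Ppath x := lintegral_congr_ae <| by
            filter_upwards [hstart x] with ω hω
            exact truncPow_succ_of_le n (show c ≤ V (ω 0) from hω ▸ h)
        _ = t * ∫⁻ ω, truncPow V c t n ω ∂Ppath x := lintegral_const_mul _ (hG n)
        _ ≤ t * (K * ENNReal.ofReal (V x)) := by gcongr; exact hK x h
        _ ≤ _ := by gcongr; exact le_add_self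
  calc
    _ = ∫⁻ x, ∫⁻ ω, truncPow V c t (n + 1) (prepend y ω) ∂Ppath x ∂π y := by
        rw [hrec y, lintegral_map (hG _) (measurable_prepend y)]
        exact Measure.lintegral_bind hmeas.aemeasurable
          ((hG _).comp (measurable_prepend y)).aemeasurable
    _ ≤ ∫⁻ x, t * (1 + K * ENNReal.ofReal (V x)) ∂π y := lintegral_mono hbound
    _ = _ := by
        have hV' := hV.ennreal_ofReal
        rw [lintegral_const_mul _ (by fun_prop), lintegral_add_left measurable_const,
          lintegral_const_mul _ hV']
        simp

end

theorem lyapunov_return_time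
    {Y : Type*} [MetricSpace Y] [MeasurableSpace Y] [BorelSpace Y]
    -- the common transition probability function of the chains
    (π : Kernel Y Y) [IsMarkovKernel π]
    -- the pathspace measures ℙ_y of the chains started at y
    (Ppath : Y → Measure (ℕ → Y)) (hmeas : Measurable Ppath)
    (hprob : ∀ y, IsProbabilityMeasure (Ppath y))
    (hrec : ∀ y, Ppath y = ((π y).bind Ppath).map (prepend y))
    -- V satisfies ∫ V dπ_y ≤ a V(y) + b
    (V : Y → ℝ) (hVmeas : Measurable V) (hVnonneg : ∀ y, 0 ≤ V y)
    (a b : ℝ) (ha : a ∈ Set.Ioo (0:ℝ) 1) (hb : 0 < b)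
    (hLyap : ∀ y, ∫⁻ x, ENNReal.ofReal (V x) ∂π y ≤ ENNReal.ofReal (a * V y + b)) :
    -- conclusion: E_y λ^{-ρ} ≤ C̃ (V(y)+1) for ρ = inf{k ≥ 1 : V(y_k) < 2b/(1-a)}
    ∃ lam Ctil : ℝ, lam ∈ Set.Ioo (0:ℝ) 1 ∧ 0 < Ctil ∧
      ∀ y, ∫⁻ ω, geomInv lam
          (⨅ k ∈ {k : ℕ | 1 ≤ k ∧ V (ω k) < 2 * b / (1 - a)}, (k : ℕ∞)) ∂Ppath y
        ≤ ENNReal.ofReal (Ctil * (V y + 1)) := by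
  obtain ⟨ha0, ha1⟩ := ha
  set c := 2 * b / (1 - a) with hc
  have h1a : 0 < 1 - a := sub_pos.2 ha1
  have hc0 : 0 < c := by positivity
  have hbc : b = (1 - a) / 2 * c := by rw [hc]; field_simp
  set lam := (3 + a) / 4 with hlam
  have hlam0 : 0 < lam := by linarith
  have hlam1 : lam < 1 := by linarith
  set t := lam⁻¹ with ht
  have ht0 : 0 < t := inv_pos.2 hlam0
  have ht1 : 1 ≤ t := (one_le_inv₀ hlam0).2 hlam1.le
  have htlam : t * lam = 1 := inv_mul_cancel₀ hlam0.ne'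
  set K := 4 / ((1 - a) * c) with hK
  have hK0 : 0 < K := by positivity
  have hKc : K * ((1 - a) * c) = 4 := by rw [hK]; field_simp
  have hstep (n : ℕ) (hn : ∀ x, c ≤ V x → ∫⁻ ω, truncPow V c (ENNReal.ofReal t) n ω ∂Ppath x ≤
      ENNReal.ofReal K * ENNReal.ofReal (V x)) (y : Y) :
      ∫⁻ ω, truncPow V c (ENNReal.ofReal t) (n + 1) ω ∂Ppath y ≤
        ENNReal.ofReal (t * (1 + K * (a * V y + b))) := by
    have hnn : 0 ≤ a * V y + b := by have := hVnonneg y; positivity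
    rw [ENNReal.ofReal_mul ht0.le, ENNReal.ofReal_add zero_le_one (by positivity),
      ENNReal.ofReal_mul hK0.le, ENNReal.ofReal_one]
    refine (lintegral_truncPow_succ_le π hmeas hprob hrec hVmeas n hn y).trans ?_
    gcongr
    exact hLyap y
  have houtside (n : ℕ) : ∀ x, c ≤ V x → ∫⁻ ω, truncPow V c (ENNReal.ofReal t) n ω ∂Ppath x ≤
      ENNReal.ofReal K * ENNReal.ofReal (V x) := by
    induction n with
    | zero =>
      intro x hx
      rw [← ENNReal.ofReal_mul hK0.le]
      simp only [truncPow, lintegral_const, measure_univ, mul_one, ENNReal.one_le_ofReal]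
      nlinarith [mul_le_mul_of_nonneg_left hx hK0.le, mul_pos hK0 hc0]
    | succ n ih =>
      intro x hx
      refine (hstep n ih x).trans ?_
      rw [← ENNReal.ofReal_mul hK0.le]
      apply ENNReal.ofReal_le_ofReal
      have hdrift : 1 + K * (a * V x + b) ≤ lam * (K * V x) := by
        have h := mul_le_mul_of_nonneg_left hx (mul_pos hK0 h1a).le
        rw [hbc, hlam]
        nlinarith
      calc
        _ ≤ t * (lam * (K * V x)) := by gcongr
        _ = K * V x := by rw [← mul_assoc, htlam, one_mul]
  refine ⟨lam, t * (1 + K * (a + b)), ⟨hlam0, hlam1⟩, by positivity, fun y => ?_⟩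
  refine (lintegral_mono fun ω => geomInv_le_iSup_truncPow hlam0 hlam1 ω).trans ?_
  have hmono : Monotone (truncPow V c (ENNReal.ofReal t)) :=
    monotone_nat_of_le_succ fun n ω => truncPow_le_succ (ENNReal.one_le_ofReal.2 ht1) n ω
  rw [lintegral_iSup (measurable_truncPow hVmeas) hmono]
  refine iSup_le fun n => (lintegral_mono (hmono n.le_succ)).trans
    ((hstep n (houtside n) y).trans (ENNReal.ofReal_le_ofReal ?_))
  rw [mul_assoc]
  gcongr
  have := hVnonneg y
  have h1 : 0 ≤ K * a := by positivity
  have h2 : 0 ≤ K * b * V y := by positivity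
  nlinarith

end
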